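/- Let φ be a comparison function, (X, d) a compact metric space with a fixed base point x_*, and (E, ‖·‖_E) a normed space. A non-empty subset A of Lip_φ(X,E) is precompact (with respect to the norm ‖f‖_φ = ‖f(x_*)‖_E + |f|_φ) if and only if the set A − A satisfies the condition (Λ) and the sections A(x) := {f(x) : f ∈ A} are precompact in E for every x ∈ X. -/

import Mathlib

open Pointwise Metric

/-- A comparison function. -/
structure IsCompFun (φ : ℝ → ℝ) : Prop where
  nonneg : ∀ t : ℝ, 0 ≤ t → 0 ≤ φ t
  map_zero : φ 0 = 0
  right_cont : ContinuousWithinAt φ (Set.Ici 0) 0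
  concave : ConcaveOn ℝ (Set.Ici 0) φ
  ne_zero : ∃ t : ℝ, 0 ≤ t ∧ φ t ≠ 0

/-- The Lipschitz seminorm `|f|_φ`. -/
noncomputable def lipSemi {X E : Type*} [MetricSpace X] [NormedAddCommGroup E]
    (φ : ℝ → ℝ) (f : X → E) : ℝ :=
  sSup {r : ℝ | ∃ x y : X, x ≠ y ∧ r = ‖f x - f y‖ / φ (dist x y)}

/-- Membership in `Lip_φ(X,E)`. -/
def MemLip {X E : Type*} [MetricSpace X] [NormedAddCommGroup E]
    (φ : ℝ → ℝ) (f : X → E) : Prop :=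
  BddAbove {r : ℝ | ∃ x y : X, x ≠ y ∧ r = ‖f x - f y‖ / φ (dist x y)}

/-- The norm `‖f‖_φ = ‖f x₀‖ + |f|_φ`. -/
noncomputable def lipNorm {X E : Type*} [MetricSpace X] [NormedAddCommGroup E]
    (φ : ℝ → ℝ) (x₀ : X) (f : X → E) : ℝ :=
  ‖f x₀‖ + lipSemi φ f

/-- Precompactness of `A` with respect to the gauge `N`. -/
def Precomp {α : Type*} [Sub α] (N : α → ℝ) (A : Set α) : Prop :=
  ∀ ε : ℝ, 0 < ε → ∃ T : Set α, T ⊆ A ∧ T.Finite ∧ ∀ f ∈ A, ∃ g ∈ T, N (f - g) ≤ ε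

/-- Condition (Λ). -/
def CondLam {X E : Type*} [MetricSpace X] [NormedAddCommGroup E]
    (φ : ℝ → ℝ) (S : Set (X → E)) : Prop :=
  ∀ ε : ℝ, 0 < ε → ∀ n : ℕ, 0 < n →
    ∃ δ : ℝ, 0 < δ ∧ ∃ (N : ℕ) (U : Fin N → Set (X × X)),
      (∀ i, U i ⊆ {p : X × X | p.1 ≠ p.2} ∧ IsOpen (U i)) ∧
      ((⋃ x : X, ball x δ ×ˢ ball x δ) ∩ {p : X × X | p.1 ≠ p.2} ⊆ ⋃ i, U i) ∧
      ((⋃ i, U i) ⊆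
        (⋃ x : X, ball x (1 / (n : ℝ)) ×ˢ ball x (1 / (n : ℝ))) ∩
          {p : X × X | p.1 ≠ p.2}) ∧
      ∀ f ∈ S, ∀ i : Fin N,
        sSup {r : ℝ | ∃ p ∈ U i, r = ‖f (Prod.fst p) - f p.2‖ / φ (dist p.1 p.2)} -
          sInf {r : ℝ | ∃ p ∈ U i, r = ‖f (Prod.fst p) - f p.2‖ / φ (dist p.1 p.2)} ≤ ε

/-- A finite family of totally bounded coordinate images admits a simultaneous finite net. -/
theorem exists_finite_net_of_totallyBounded_coords {α ι M : Type*} [PseudoMetricSpace M]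
    (u : α → ι → M) (F : Finset ι) {η : ℝ} (hη : 0 < η) (S : Set α)
    (hS : ∀ i ∈ F, TotallyBounded ((fun a => u a i) '' S)) :
    ∃ T ⊆ S, T.Finite ∧ ∀ a ∈ S, ∃ b ∈ T, ∀ i ∈ F, dist (u a i) (u b i) < η := by
  classical
  induction F using Finset.induction_on generalizing S with
  | empty =>
    rcases S.eq_empty_or_nonempty with rfl | ⟨a, ha⟩
    · exact ⟨∅, by simp, by simp, by simp⟩
    · exact ⟨{a}, by simpa using ha, by simp, by simp⟩
  | insert i F _ ih =>
    obtain ⟨C, hC, hcov⟩ := Metric.totallyBounded_iff.1 (hS i (by simp)) (η / 2) (half_pos hη)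
    have key : ∀ c : M, ∃ T ⊆ {a ∈ S | dist (u a i) c < η / 2}, T.Finite ∧
        ∀ a ∈ {a ∈ S | dist (u a i) c < η / 2}, ∃ b ∈ T, ∀ j ∈ F,
          dist (u a j) (u b j) < η := fun c =>
      ih _ fun j hj => (hS j (by simp [hj])).subset (Set.image_mono (Set.sep_subset _ _))
    choose T hTS hTf hT using key
    refine ⟨⋃ c ∈ C, T c, ?_, hC.biUnion fun c _ => hTf c, fun a ha => ?_⟩
    · exact Set.iUnion₂_subset fun c _ => (hTS c).trans (Set.sep_subset _ _)
    · obtain ⟨c, hc, hac⟩ := Set.mem_iUnion₂.1 (hcov (Set.mem_image_of_mem _ ha))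
      obtain ⟨b, hb, hab⟩ := hT c a ⟨ha, hac⟩
      refine ⟨b, Set.mem_iUnion₂.2 ⟨c, hc, hb⟩, fun j hj => ?_⟩
      rcases Finset.mem_insert.1 hj with rfl | hj
      · have h1 : dist (u a j) c < η / 2 := hac
        have h2 : dist (u b j) c < η / 2 := (hTS c hb).2
        linarith [dist_triangle_right (u a j) (u b j) c]
      · exact hab j hj

theorem sSup_sub_sInf_image_le {α : Type*} {U : Set α} {F : α → ℝ} {ε : ℝ} (hε : 0 ≤ ε)
    (h : ∀ p ∈ U, ∀ q ∈ U, F p ≤ F q + ε) :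
    sSup {r : ℝ | ∃ p ∈ U, r = F p} - sInf {r : ℝ | ∃ p ∈ U, r = F p} ≤ ε := by
  rcases U.eq_empty_or_nonempty with rfl | ⟨p₀, hp₀⟩
  · simpa using hε
  · rw [sub_le_iff_le_add]
    refine csSup_le ⟨_, p₀, hp₀, rfl⟩ ?_
    rintro _ ⟨p, hp, rfl⟩
    rw [← sub_le_iff_le_add']
    refine le_csInf ⟨_, p₀, hp₀, rfl⟩ ?_
    rintro _ ⟨q, hq, rfl⟩
    linarith [h p hp q hq]

namespace IsCompFun

variable {φ : ℝ → ℝ}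

theorem pos (hφ : IsCompFun φ) {t : ℝ} (ht : 0 < t) : 0 < φ t := by
  obtain ⟨s, hs, hs'⟩ := hφ.ne_zero
  have hs0 : 0 < s := hs.lt_of_ne (by rintro rfl; exact hs' hφ.map_zero)
  have hφs : 0 < φ s := (hφ.nonneg s hs).lt_of_ne hs'.symm
  -- `t` lies on the chord from `0` to `s`, or on the chord from `s` to `2 * t`
  have h := hφ.concave.2
  by_cases hts : t ≤ s
  · have := h (Set.mem_Ici.2 hs) (Set.self_mem_Ici (a := (0 : ℝ)))
      (show 0 ≤ t / s by positivity)
      (show 0 ≤ 1 - t / s by rw [sub_nonneg, div_le_one hs0]; exact hts) (by ring)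
    simp only [smul_eq_mul, mul_zero, add_zero, hφ.map_zero] at this
    rw [div_mul_cancel₀ _ hs0.ne'] at this
    exact lt_of_lt_of_le (by positivity) this
  · push Not at hts
    have h2 : 0 < 2 * t - s := by linarith
    have := h (Set.mem_Ici.2 hs) (show 2 * t ∈ Set.Ici (0 : ℝ) from Set.mem_Ici.2 (by linarith))
      (show 0 ≤ t / (2 * t - s) by positivity)
      (show 0 ≤ (t - s) / (2 * t - s) from div_nonneg (by linarith) h2.le)
      (by rw [← add_div, div_eq_one_iff_eq h2.ne']; ring)
    simp only [smul_eq_mul] at this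
    have e : t / (2 * t - s) * s + (t - s) / (2 * t - s) * (2 * t) = t := by
      rw [div_mul_eq_mul_div, div_mul_eq_mul_div, ← add_div, div_eq_iff h2.ne']
      ring
    rw [e] at this
    refine lt_of_lt_of_le ?_ this
    have : 0 ≤ (t - s) / (2 * t - s) * φ (2 * t) :=
      mul_nonneg (div_nonneg (by linarith) h2.le) (hφ.nonneg _ (by linarith))
    have : 0 < t / (2 * t - s) * φ s := by positivity
    linarith

theorem continuousOn_Ioi (hφ : IsCompFun φ) : ContinuousOn φ (Set.Ioi 0) := by
  simpa using hφ.concave.continuousOn_interior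

theorem exists_forall_lt (hφ : IsCompFun φ) {η : ℝ} (hη : 0 < η) :
    ∃ r > 0, ∀ t, 0 ≤ t → t < r → φ t < η := by
  obtain ⟨r, hr, h⟩ := Metric.continuousWithinAt_iff.1 hφ.right_cont η hη
  refine ⟨r, hr, fun t ht htr => ?_⟩
  have := h (x := t) ht (by simpa [abs_of_nonneg ht] using htr)
  rw [hφ.map_zero, Real.dist_eq, sub_zero] at this
  exact (le_abs_self _).trans_lt this

theorem exists_pos_forall_le (hφ : IsCompFun φ) {δ : ℝ} (hδ : 0 < δ) (D : ℝ) :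
    ∃ c > 0, ∀ t, δ ≤ t → t ≤ D → c ≤ φ t := by
  have hc : ContinuousOn φ (Set.Icc δ D) :=
    hφ.continuousOn_Ioi.mono fun t ht => hδ.trans_le ht.1
  obtain ⟨c, hc0, hc⟩ := isCompact_Icc.exists_forall_le' hc (a := 0)
    fun t ht => hφ.pos (hδ.trans_le ht.1)
  exact ⟨c, hc0, fun t h1 h2 => hc t ⟨h1, h2⟩⟩

end IsCompFun

section LipQuot

variable {X E : Type*} [MetricSpace X] [NormedAddCommGroup E] {φ : ℝ → ℝ} {f g : X → E}

/-- The difference quotient `‖f x - f y‖ / φ (d (x, y))`. -/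
noncomputable def lipQuot (φ : ℝ → ℝ) (f : X → E) (p : X × X) : ℝ :=
  ‖f p.1 - f p.2‖ / φ (dist p.1 p.2)

theorem lipQuot_nonneg (hφ : IsCompFun φ) (f : X → E) (p : X × X) : 0 ≤ lipQuot φ f p :=
  div_nonneg (norm_nonneg _) (hφ.nonneg _ dist_nonneg)

theorem lipSemi_nonneg (hφ : IsCompFun φ) (f : X → E) : 0 ≤ lipSemi φ f := by
  apply Real.sSup_nonneg
  rintro _ ⟨x, y, -, rfl⟩
  exact lipQuot_nonneg hφ f (x, y)

theorem MemLip.lipQuot_le (hf : MemLip φ f) {p : X × X} (hp : p.1 ≠ p.2) :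
    lipQuot φ f p ≤ lipSemi φ f :=
  le_csSup hf ⟨p.1, p.2, hp, rfl⟩

theorem MemLip.norm_sub_le (hφ : IsCompFun φ) (hf : MemLip φ f) (x y : X) :
    ‖f x - f y‖ ≤ lipSemi φ f * φ (dist x y) := by
  rcases eq_or_ne x y with rfl | h
  · simp [hφ.map_zero]
  · exact (div_le_iff₀ (hφ.pos (dist_pos.2 h))).1 (hf.lipQuot_le (p := (x, y)) h)

theorem lipQuot_sub_le (hφ : IsCompFun φ) (f g : X → E) (p : X × X) :
    lipQuot φ (f - g) p ≤ lipQuot φ f p + lipQuot φ g p := by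
  rw [lipQuot, lipQuot, lipQuot, ← add_div]
  refine div_le_div_of_nonneg_right ?_ (hφ.nonneg _ dist_nonneg)
  simp only [Pi.sub_apply]
  rw [sub_sub_sub_comm]
  exact _root_.norm_sub_le _ _

theorem abs_lipQuot_sub_le (hφ : IsCompFun φ) (f g : X → E) (p : X × X) :
    |lipQuot φ f p - lipQuot φ g p| ≤ lipQuot φ (f - g) p := by
  have hp := hφ.nonneg (dist p.1 p.2) dist_nonneg
  rw [lipQuot, lipQuot, lipQuot, ← sub_div, abs_div, abs_of_nonneg hp]
  refine div_le_div_of_nonneg_right ?_ hp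
  simp only [Pi.sub_apply]
  rw [sub_sub_sub_comm]
  exact abs_norm_sub_norm_le _ _

theorem lipSemi_le_lipNorm (φ : ℝ → ℝ) (x₀ : X) (f : X → E) :
    lipSemi φ f ≤ lipNorm φ x₀ f :=
  le_add_of_nonneg_left (norm_nonneg _)

theorem MemLip.sub (hφ : IsCompFun φ) (hf : MemLip φ f) (hg : MemLip φ g) :
    MemLip φ (f - g) := by
  refine ⟨lipSemi φ f + lipSemi φ g, ?_⟩
  rintro _ ⟨x, y, h, rfl⟩
  exact (lipQuot_sub_le hφ f g (x, y)).trans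
    (add_le_add (hf.lipQuot_le (p := (x, y)) h) (hg.lipQuot_le (p := (x, y)) h))

theorem continuousOn_lipQuot (hφ : IsCompFun φ) (hf : MemLip φ f) :
    ContinuousOn (lipQuot φ f) {p : X × X | p.1 ≠ p.2} := by
  have hfc : Continuous f := by
    rw [Metric.continuous_iff]
    intro x ε hε
    have hL := lipSemi_nonneg hφ f
    obtain ⟨r, hr, h⟩ := hφ.exists_forall_lt (η := ε / (lipSemi φ f + 1)) (by positivity)
    refine ⟨r, hr, fun y hy => ?_⟩
    have h1 := (lt_div_iff₀ (by positivity)).1 (h _ dist_nonneg hy)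
    have h2 := hf.norm_sub_le hφ y x
    rw [dist_eq_norm]
    nlinarith [hφ.nonneg (dist y x) dist_nonneg]
  refine ContinuousOn.div (by fun_prop) ?_ fun p hp => (hφ.pos (dist_pos.2 hp)).ne'
  exact hφ.continuousOn_Ioi.comp (by fun_prop) fun p hp => dist_pos.2 hp

theorem norm_apply_le (hφ : IsCompFun φ) (hf : MemLip φ f) (x₀ x : X) :
    ‖f x‖ ≤ (1 + φ (dist x x₀)) * lipNorm φ x₀ f := by
  have h1 := hf.norm_sub_le hφ x x₀
  have h2 := norm_le_norm_add_norm_sub' (f x) (f x₀)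
  have h3 := lipSemi_nonneg hφ f
  have h4 := hφ.nonneg (dist x x₀) dist_nonneg
  have h5 := mul_nonneg h4 (norm_nonneg (f x₀))
  rw [lipNorm]
  nlinarith

variable {A : Set (X → E)} {x₀ : X}

theorem Precomp.totallyBounded_section (hφ : IsCompFun φ) (hAL : ∀ f ∈ A, MemLip φ f)
    (h : Precomp (lipNorm φ x₀) A) (x : X) :
    TotallyBounded ((fun f : X → E => f x) '' A) := by
  rw [Metric.totallyBounded_iff]
  intro ε hε
  have hc : 0 < 1 + φ (dist x x₀) := by linarith [hφ.nonneg (dist x x₀) dist_nonneg]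
  obtain ⟨T, hTA, hTf, hT⟩ := h (ε / 2 / (1 + φ (dist x x₀))) (by positivity)
  refine ⟨(fun f => f x) '' T, hTf.image _, ?_⟩
  rintro _ ⟨f, hf, rfl⟩
  obtain ⟨g, hg, hfg⟩ := hT f hf
  refine Set.mem_iUnion₂.2 ⟨g x, Set.mem_image_of_mem _ hg, ?_⟩
  rw [Metric.mem_ball, dist_eq_norm]
  have h1 := norm_apply_le hφ ((hAL f hf).sub hφ (hAL g (hTA hg))) x₀ x
  rw [le_div_iff₀ hc] at hfg
  simp only [Pi.sub_apply] at h1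
  linarith

theorem Precomp.condLam_sub (hφ : IsCompFun φ) (hAL : ∀ f ∈ A, MemLip φ f)
    (h : Precomp (lipNorm φ x₀) A) : CondLam φ (A - A) := by
  intro ε hε n hn
  obtain ⟨T, hTA, hTf, hT⟩ := h (ε / 6) (by positivity)
  have hTT : (T - T).Finite := hTf.sub hTf
  have hTL : ∀ k ∈ T - T, MemLip φ k := by
    rintro _ ⟨f, hf, g, hg, rfl⟩
    exact (hAL f (hTA hf)).sub hφ (hAL g (hTA hg))
  have hoff : IsOpen {p : X × X | p.1 ≠ p.2} := isOpen_ne_fun continuous_fst continuous_snd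
  obtain ⟨C, -, hCf, hC⟩ := exists_finite_net_of_totallyBounded_coords
    (fun (p : X × X) (k : X → E) => lipQuot φ k p) hTT.toFinset (η := ε / 6) (by positivity)
    {p : X × X | p.1 ≠ p.2} (fun k hk => by
      refine (totallyBounded_Icc 0 (lipSemi φ k)).subset ?_
      rintro _ ⟨p, hp, rfl⟩
      exact ⟨lipQuot_nonneg hφ k p, (hTL k (hTT.mem_toFinset.1 hk)).lipQuot_le hp⟩)
  have hn' : (0 : ℝ) < 1 / n := by positivity
  set W : Set (X × X) := ⋃ x : X, ball x (1 / (n : ℝ)) ×ˢ ball x (1 / (n : ℝ))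
  have hWo : IsOpen W := isOpen_iUnion fun x => isOpen_ball.prod isOpen_ball
  have := hCf.to_subtype
  obtain ⟨N, ⟨e⟩⟩ := Finite.exists_equiv_fin C
  let V : X × X → Set (X × X) := fun c => W ∩ {p | p.1 ≠ p.2} ∩
    ⋂ k ∈ T - T, {p | p.1 ≠ p.2} ∩ lipQuot φ k ⁻¹' ball (lipQuot φ k c) (ε / 6)
  have hVo : ∀ c, IsOpen (V c) := fun c => (hWo.inter hoff).inter <|
    hTT.isOpen_biInter fun k hk =>
      (continuousOn_lipQuot hφ (hTL k hk)).isOpen_inter_preimage hoff isOpen_ball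
  have hVW : ∀ c, V c ⊆ W ∩ {p | p.1 ≠ p.2} := fun c => Set.inter_subset_left
  refine ⟨1 / n, hn', N, fun i => V (e.symm i), fun i => ⟨?_, hVo _⟩, ?_,
    Set.iUnion_subset fun i => hVW _, ?_⟩
  · exact (hVW _).trans Set.inter_subset_right
  · intro p hp
    obtain ⟨c, hc, hpc⟩ := hC p hp.2
    refine Set.mem_iUnion.2 ⟨e ⟨c, hc⟩, ?_⟩
    rw [Equiv.symm_apply_apply]
    exact ⟨hp, Set.mem_iInter₂.2 fun k hk => ⟨hp.2, hpc k (hTT.mem_toFinset.2 hk)⟩⟩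
  · rintro _ ⟨f, hf, g, hg, rfl⟩ i
    refine sSup_sub_sInf_image_le hε.le fun p hp q hq => ?_
    change lipQuot φ (f - g) p ≤ lipQuot φ (f - g) q + ε
    obtain ⟨f', hf', hff⟩ := hT f hf
    obtain ⟨g', hg', hgg⟩ := hT g hg
    have hk : f' - g' ∈ T - T := Set.sub_mem_sub hf' hg'
    have hff' := (hAL f hf).sub hφ (hAL f' (hTA hf'))
    have hgg' := (hAL g hg).sub hφ (hAL g' (hTA hg'))
    have close : ∀ p : X × X, p.1 ≠ p.2 →
        |lipQuot φ (f - g) p - lipQuot φ (f' - g') p| ≤ ε / 3 := by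
      intro p hp
      have h1 := (hff'.lipQuot_le hp).trans (lipSemi_le_lipNorm φ x₀ _)
      have h2 := (hgg'.lipQuot_le hp).trans (lipSemi_le_lipNorm φ x₀ _)
      have h3 := abs_lipQuot_sub_le hφ (f - g) (f' - g') p
      have h4 := lipQuot_sub_le hφ (f - f') (g - g') p
      rw [sub_sub_sub_comm] at h3
      linarith
    have h1 := (abs_le.1 (close p (hVW _ hp).2)).2
    have h2 := (abs_le.1 (close q (hVW _ hq).2)).1
    have h3 : dist _ _ < ε / 6 := (Set.mem_iInter₂.1 hp.2 _ hk).2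
    have h4 : dist _ _ < ε / 6 := (Set.mem_iInter₂.1 hq.2 _ hk).2
    rw [Real.dist_eq] at h3 h4
    linarith [(abs_lt.1 h3).2, (abs_lt.1 h4).1]

theorem CondLam.exists_finset {S : Set (X → E)} (hφ : IsCompFun φ)
    (hSL : ∀ f ∈ S, MemLip φ f) (h : CondLam φ S) {ε : ℝ} (hε : 0 < ε) :
    ∃ δ > 0, ∃ P : Finset (X × X), (∀ p ∈ P, p.1 ≠ p.2) ∧
      ∀ f ∈ S, ∀ x y, x ≠ y → dist x y < δ →
        ∃ p ∈ P, lipQuot φ f (x, y) ≤ lipQuot φ f p + ε := by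
  classical
  obtain ⟨δ, hδ, N, U, hU, hcov, -, hosc⟩ := h ε hε 1 one_pos
  have key : ∀ i, ∃ Q : Finset (X × X), ↑Q ⊆ U i ∧ ((U i).Nonempty → Q.Nonempty) := by
    intro i
    rcases (U i).eq_empty_or_nonempty with hi | ⟨p, hp⟩
    · exact ⟨∅, by simp, by simp [hi]⟩
    · exact ⟨{p}, by simpa using hp, by simp⟩
  choose Q hQU hQ using key
  refine ⟨δ, hδ, Finset.univ.biUnion Q, fun p hp => ?_, fun f hf x y hxy hd => ?_⟩
  · obtain ⟨i, -, hi⟩ := Finset.mem_biUnion.1 hp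
    exact (hU i).1 (hQU i hi)
  · obtain ⟨i, hi⟩ := Set.mem_iUnion.1 (hcov (a := (x, y))
      ⟨Set.mem_iUnion.2 ⟨x, mem_ball_self hδ, by rwa [mem_ball']⟩, hxy⟩)
    obtain ⟨p, hp⟩ := hQ i ⟨_, hi⟩
    refine ⟨p, Finset.mem_biUnion.2 ⟨i, Finset.mem_univ i, hp⟩, ?_⟩
    have h1 : lipQuot φ f (x, y) ≤ sSup {r : ℝ | ∃ p ∈ U i, r = lipQuot φ f p} := by
      refine le_csSup ⟨lipSemi φ f, ?_⟩ ⟨_, hi, rfl⟩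
      rintro _ ⟨q, hq, rfl⟩
      exact (hSL f hf).lipQuot_le ((hU i).1 hq)
    have h2 : sInf {r : ℝ | ∃ p ∈ U i, r = lipQuot φ f p} ≤ lipQuot φ f p := by
      refine csInf_le ⟨0, ?_⟩ ⟨_, hQU i hp, rfl⟩
      rintro _ ⟨q, -, rfl⟩
      exact lipQuot_nonneg hφ f q
    have h3 : sSup {r : ℝ | ∃ p ∈ U i, r = lipQuot φ f p} -
        sInf {r : ℝ | ∃ p ∈ U i, r = lipQuot φ f p} ≤ ε := hosc f hf i
    linarith

theorem precomp_of_condLam_sub [CompactSpace X] (hφ : IsCompFun φ)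
    (hAL : ∀ f ∈ A, MemLip φ f) (hΛ : CondLam φ (A - A))
    (hsec : ∀ x : X, TotallyBounded ((fun f : X → E => f x) '' A)) :
    Precomp (lipNorm φ x₀) A := by
  classical
  intro ε hε
  have hAAL : ∀ k ∈ A - A, MemLip φ k := by
    rintro _ ⟨f, hf, g, hg, rfl⟩
    exact (hAL f hf).sub hφ (hAL g hg)
  obtain ⟨δ, hδ, P, hP, hPosc⟩ := hΛ.exists_finset hφ hAAL (ε := ε / 4) (by positivity)
  obtain ⟨c, hc, hcφ⟩ := hφ.exists_pos_forall_le hδ (diam (Set.univ : Set X))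
  obtain ⟨r, hr, hrφ⟩ := hφ.exists_forall_lt (η := c / 4) (by positivity)
  obtain ⟨G, -, hGf, hG⟩ := (isCompact_univ (X := X)).finite_cover_balls (lt_min hδ hr)
  -- the tolerance on the finite sample of points
  obtain ⟨η, hη, hη₁, hη₂, hηP⟩ : ∃ η : ℝ, 0 < η ∧ η < ε / 2 ∧ η < c * ε / 8 ∧
      ∀ p ∈ P, η < ε / 8 * φ (dist p.1 p.2) := by
    have small : ∀ b : ℝ, 0 < b → ∀ᶠ η in nhdsWithin (0 : ℝ) (Set.Ioi 0), η < b :=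
      fun b hb => nhdsWithin_le_nhds (eventually_lt_nhds hb)
    have h := (P.eventually_all (l := nhdsWithin (0 : ℝ) (Set.Ioi 0))
      (p := fun p η => η < ε / 8 * φ (dist p.1 p.2))).2 fun p hp =>
        small _ (mul_pos (by positivity) (hφ.pos (dist_pos.2 (hP p hp))))
    exact (eventually_mem_nhdsWithin.and ((small _ (by positivity)).and
      ((small _ (by positivity)).and h))).exists
  obtain ⟨T, hTA, hTf, hT⟩ := exists_finite_net_of_totallyBounded_coords
    (fun (f : X → E) x => f x) ({x₀} ∪ (P.image Prod.fst ∪ P.image Prod.snd) ∪ hGf.toFinset)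
    hη A fun x _ => hsec x
  refine ⟨T, hTA, hTf, fun f hf => ?_⟩
  obtain ⟨g, hg, hfg⟩ := hT f hf
  refine ⟨g, hg, ?_⟩
  set h := f - g with hh
  have hhA : h ∈ A - A := Set.sub_mem_sub hf (hTA hg)
  have hF : ∀ x ∈ {x₀} ∪ (P.image Prod.fst ∪ P.image Prod.snd) ∪ hGf.toFinset, ‖h x‖ < η :=
    fun x hx => by simpa [hh, dist_eq_norm] using hfg x hx
  have hx₀ : ‖h x₀‖ < η := hF x₀ (by simp)
  have hhP : ∀ p ∈ P, lipQuot φ h p ≤ ε / 4 := by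
    intro p hp
    have h1 : ‖h p.1‖ < η := hF _ (by
      simp only [Finset.mem_union]
      exact Or.inl (Or.inr (Or.inl (Finset.mem_image_of_mem _ hp))))
    have h2 : ‖h p.2‖ < η := hF _ (by
      simp only [Finset.mem_union]
      exact Or.inl (Or.inr (Or.inr (Finset.mem_image_of_mem _ hp))))
    rw [lipQuot, div_le_iff₀ (hφ.pos (dist_pos.2 (hP p hp)))]
    linarith [_root_.norm_sub_le (h p.1) (h p.2), hηP p hp]
  have near : ∀ x y, x ≠ y → dist x y < δ → lipQuot φ h (x, y) ≤ ε / 2 := by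
    intro x y hxy hd
    obtain ⟨p, hp, hle⟩ := hPosc h hhA x y hxy hd
    linarith [hhP p hp]
  have unif : ∀ x, ‖h x‖ ≤ c * ε / 4 := by
    intro x
    obtain ⟨y, hy, hxy⟩ := Set.mem_iUnion₂.1 (hG (Set.mem_univ x))
    have hy' : ‖h y‖ < η := hF y (by simp [hy])
    rcases eq_or_ne x y with rfl | hne
    · nlinarith
    · have hd : dist x y < min δ r := hxy
      have h1 := near x y hne (hd.trans_le (min_le_left _ _))
      rw [lipQuot, div_le_iff₀ (hφ.pos (dist_pos.2 hne))] at h1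
      have h2 := hrφ _ dist_nonneg (hd.trans_le (min_le_right _ _))
      have h3 := norm_le_norm_add_norm_sub' (h x) (h y)
      dsimp only at h1
      nlinarith
  have hsemi : lipSemi φ h ≤ ε / 2 := by
    refine Real.sSup_le ?_ (by positivity)
    rintro _ ⟨x, y, hxy, rfl⟩
    rcases lt_or_ge (dist x y) δ with hd | hd
    · exact near x y hxy hd
    · rw [div_le_iff₀ (hφ.pos (dist_pos.2 hxy))]
      have h1 := hcφ _ hd (dist_le_diam_of_mem isCompact_univ.isBounded trivial trivial)
      have h2 := _root_.norm_sub_le (h x) (h y)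
      nlinarith [unif x, unif y]
  rw [lipNorm]
  linarith

end LipQuot

/-- **Second compactness criterion in `Lip_φ(X,E)` for compact `X`.**  A non-empty
`A ⊆ Lip_φ(X,E)` is precompact iff `A - A` satisfies (Λ) and every section `A(x)` is
precompact in `E`. -/
theorem stmt_18 {X E : Type*} [MetricSpace X] [CompactSpace X]
    [NormedAddCommGroup E] [NormedSpace ℝ E]
    (φ : ℝ → ℝ) (hφ : IsCompFun φ) (x₀ : X)
    (A : Set (X → E)) (hA : A.Nonempty) (hAL : ∀ f ∈ A, MemLip φ f) :
    Precomp (lipNorm φ x₀) A ↔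
      CondLam φ (A - A) ∧ ∀ x : X, TotallyBounded ((fun f : X → E => f x) '' A) := by
  exact ⟨fun h => ⟨h.condLam_sub hφ hAL, h.totallyBounded_section hφ hAL⟩,
    fun h => precomp_of_condLam_sub hφ hAL h.1 h.2⟩
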